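/- arXiv:1712.03895 — 2 statements merged into one kernel-verified Lean document; each statement's English description precedes it below -/
import Mathlib

section
/- Let F be a degree-3 foliation of ℙ²(ℂ) that is not linearly conjugate to the foliation F₂ given in the chart z = 1 by ω̄₂ = x³dx + y³(x dy − y dx). Suppose F possesses a double inflection point: a nonsingular point m such that, in affine coordinates with m = (0,0) and the tangent line of F at m equal to (x = 0), a defining 1-form ω = A dx + B dy satisfies A(0,0) ≠ 0 and B(0,y) vanishes at y = 0 to order exactly 3. Then F degenerates onto F₂: O(F₂) is contained in the closure of O(F) in F(3). -/
open MvPolynomial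

noncomputable section

/-- Substitution of the linear change of variables on `ℂ³` given by the matrix `M`. -/
def subst3 (M : Matrix (Fin 3) (Fin 3) ℂ) (P : MvPolynomial (Fin 3) ℂ) :
    MvPolynomial (Fin 3) ℂ :=
  aeval (fun i => ∑ j, C (M i j) * X j) P

/-- Pullback of the 1-form with coefficient vector `Ω` by the linear map of matrix `M`. -/
def pb3 (M : Matrix (Fin 3) (Fin 3) ℂ) (Ω : Fin 3 → MvPolynomial (Fin 3) ℂ) :
    Fin 3 → MvPolynomial (Fin 3) ℂ :=
  fun i => ∑ j, C (M j i) * subst3 M (Ω j)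

/-- Two foliations (given by their projective 1-forms) are linearly conjugate:
`T*Ω = c·Ω'` for some `T ∈ GL₃(ℂ)` and `c ∈ ℂ*`. -/
def LinConj3 (Ω Ω' : Fin 3 → MvPolynomial (Fin 3) ℂ) : Prop :=
  ∃ (M : Matrix (Fin 3) (Fin 3) ℂ) (c : ℂ), IsUnit M.det ∧ c ≠ 0 ∧
    pb3 M Ω = fun i => C c * Ω' i

/-- The orbit of the 1-form `Ω` under pullback by `GL₃(ℂ)` and nonzero rescaling
(the cone over the `PGL₃(ℂ)`-orbit of the corresponding foliation). -/
def OrbitOf (Ω : Fin 3 → MvPolynomial (Fin 3) ℂ) :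
    Set (Fin 3 → MvPolynomial (Fin 3) ℂ) :=
  {Ω' | LinConj3 Ω Ω'}

/-- `Ω` defines a degree-`d` foliation of `ℙ²(ℂ)`: it is a nonzero 1-form with
homogeneous coefficients of degree `d + 1` annihilating the radial vector field and
with no common factor. -/
def IsFolDeg (d : ℕ) (Ω : Fin 3 → MvPolynomial (Fin 3) ℂ) : Prop :=
  Ω ≠ 0 ∧ (∀ i, (Ω i).IsHomogeneous (d + 1)) ∧
    X 0 * Ω 0 + X 1 * Ω 1 + X 2 * Ω 2 = 0 ∧
    ∀ h : MvPolynomial (Fin 3) ℂ, (∀ i, h ∣ Ω i) → IsUnit h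

/-- The coefficient vector of a triple of polynomials. -/
def coeffs (Ω : Fin 3 → MvPolynomial (Fin 3) ℂ) : Fin 3 → (Fin 3 →₀ ℕ) → ℂ :=
  fun i m => coeff m (Ω i)

/-- Closure, inside the space `F(d)` of degree-`d` foliations with its classical
topology (read off on the coefficients), of a set of defining 1-forms. -/
def FClos (d : ℕ) (S : Set (Fin 3 → MvPolynomial (Fin 3) ℂ)) :
    Set (Fin 3 → MvPolynomial (Fin 3) ℂ) :=
  {Ω' | IsFolDeg d Ω' ∧ coeffs Ω' ∈ closure (coeffs '' S)}

/-- `√3` as a complex number. -/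
def s3 : ℂ := (Real.sqrt 3 : ℝ)

/-- Projective 1-form of `H₁ : y³dx − x³dy`. -/
def OmH1 : Fin 3 → MvPolynomial (Fin 3) ℂ :=
  ![X 2 * X 1 ^ 3, -(X 2 * X 0 ^ 3), X 0 ^ 3 * X 1 - X 0 * X 1 ^ 3]

/-- Projective 1-form of `H₂ : x³dx − y³dy`. -/
def OmH2 : Fin 3 → MvPolynomial (Fin 3) ℂ :=
  ![X 2 * X 0 ^ 3, -(X 2 * X 1 ^ 3), X 1 ^ 4 - X 0 ^ 4]

/-- Projective 1-form of `H₃ : y²(3x+y)dx − x²(x+3y)dy`. -/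
def OmH3 : Fin 3 → MvPolynomial (Fin 3) ℂ :=
  ![X 2 * (3 * X 0 * X 1 ^ 2 + X 1 ^ 3), -(X 2 * (X 0 ^ 3 + 3 * X 0 ^ 2 * X 1)),
    X 0 ^ 3 * X 1 - X 0 * X 1 ^ 3]

/-- Projective 1-form of `H₄ : y²(3x+y)dx + x²(x+3y)dy`. -/
def OmH4 : Fin 3 → MvPolynomial (Fin 3) ℂ :=
  ![X 2 * (3 * X 0 * X 1 ^ 2 + X 1 ^ 3), X 2 * (X 0 ^ 3 + 3 * X 0 ^ 2 * X 1),
    -(X 0 ^ 3 * X 1 + 6 * X 0 ^ 2 * X 1 ^ 2 + X 0 * X 1 ^ 3)]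

/-- Projective 1-form of `H₅ : 2y³dx + x²(3y−2x)dy`. -/
def OmH5 : Fin 3 → MvPolynomial (Fin 3) ℂ :=
  ![2 * X 2 * X 1 ^ 3, X 2 * (3 * X 0 ^ 2 * X 1 - 2 * X 0 ^ 3),
    -(2 * X 0 * X 1 ^ 3 + 3 * X 0 ^ 2 * X 1 ^ 2 - 2 * X 0 ^ 3 * X 1)]

/-- Projective 1-form of `H₆ : (4x³−6x²y+4y³)dx + x²(3y−2x)dy`. -/
def OmH6 : Fin 3 → MvPolynomial (Fin 3) ℂ :=
  ![X 2 * (4 * X 0 ^ 3 - 6 * X 0 ^ 2 * X 1 + 4 * X 1 ^ 3),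
    X 2 * (3 * X 0 ^ 2 * X 1 - 2 * X 0 ^ 3),
    -(4 * X 0 ^ 4 - 8 * X 0 ^ 3 * X 1 + 3 * X 0 ^ 2 * X 1 ^ 2 + 4 * X 0 * X 1 ^ 3)]

/-- Projective 1-form of `H₇ : y³dx + x(3y²−x²)dy`. -/
def OmH7 : Fin 3 → MvPolynomial (Fin 3) ℂ :=
  ![X 2 * X 1 ^ 3, X 2 * (3 * X 0 * X 1 ^ 2 - X 0 ^ 3),
    X 0 ^ 3 * X 1 - 4 * X 0 * X 1 ^ 3]

/-- Projective 1-form of `H₈ : x(x²−3y²)dx − 4y³dy`. -/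
def OmH8 : Fin 3 → MvPolynomial (Fin 3) ℂ :=
  ![X 2 * (X 0 ^ 3 - 3 * X 0 * X 1 ^ 2), -(4 * X 2 * X 1 ^ 3),
    -(X 0 ^ 4 - 3 * X 0 ^ 2 * X 1 ^ 2 - 4 * X 1 ^ 4)]

/-- Projective 1-form of `H₉ : y²((−3+i√3)x+2y)dx + x²((1+i√3)x−2i√3·y)dy`. -/
def OmH9 : Fin 3 → MvPolynomial (Fin 3) ℂ :=
  ![X 2 * (C (-3 + Complex.I * s3) * X 0 * X 1 ^ 2 + 2 * X 1 ^ 3),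
    X 2 * (C (1 + Complex.I * s3) * X 0 ^ 3 - C (2 * (Complex.I * s3)) * X 0 ^ 2 * X 1),
    -(C (1 + Complex.I * s3) * X 0 ^ 3 * X 1 + C (-3 - Complex.I * s3) * X 0 ^ 2 * X 1 ^ 2 +
      2 * X 0 * X 1 ^ 3)]

/-- Projective 1-form of
`H₁₁ : (3x³+3√3x²y+3xy²+√3y³)dx + (√3x³+3x²y+3√3xy²+3y³)dy`. -/
def OmH11 : Fin 3 → MvPolynomial (Fin 3) ℂ :=
  ![X 2 * (3 * X 0 ^ 3 + C (3 * s3) * X 0 ^ 2 * X 1 + 3 * X 0 * X 1 ^ 2 + C s3 * X 1 ^ 3),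
    X 2 * (C s3 * X 0 ^ 3 + 3 * X 0 ^ 2 * X 1 + C (3 * s3) * X 0 * X 1 ^ 2 + 3 * X 1 ^ 3),
    -(3 * X 0 ^ 4 + C (4 * s3) * X 0 ^ 3 * X 1 + 6 * X 0 ^ 2 * X 1 ^ 2 +
      C (4 * s3) * X 0 * X 1 ^ 3 + 3 * X 1 ^ 4)]

/-- Projective 1-form of `F₁ : y³dx + x³(x dy − y dx)`. -/
def OmF1 : Fin 3 → MvPolynomial (Fin 3) ℂ :=
  ![X 2 * X 1 ^ 3 - X 0 ^ 3 * X 1, X 0 ^ 4, -(X 0 * X 1 ^ 3)]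

/-- Projective 1-form of `F₂ : x³dx + y³(x dy − y dx)`. -/
def OmF2 : Fin 3 → MvPolynomial (Fin 3) ℂ :=
  ![X 2 * X 0 ^ 3 - X 1 ^ 4, X 0 * X 1 ^ 3, -(X 0 ^ 4)]

/-- Projective 1-form of the Fermat foliation `F₃ : (x³−x)dy − (y³−y)dx`. -/
def OmF3 : Fin 3 → MvPolynomial (Fin 3) ℂ :=
  ![X 1 * X 2 ^ 3 - X 1 ^ 3 * X 2, X 0 ^ 3 * X 2 - X 0 * X 2 ^ 3,
    X 0 * X 1 ^ 3 - X 0 ^ 3 * X 1]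

/-- Projective 1-form of `F₄ : (x³+y³)dx + x³(x dy − y dx)`. -/
def OmF4 : Fin 3 → MvPolynomial (Fin 3) ℂ :=
  ![X 2 * (X 0 ^ 3 + X 1 ^ 3) - X 0 ^ 3 * X 1, X 0 ^ 4, -(X 0 ^ 4 + X 0 * X 1 ^ 3)]

/-- Projective 1-form of `F₅ : y²(y dx + 2x dy) + x³(x dy − y dx)`. -/
def OmF5 : Fin 3 → MvPolynomial (Fin 3) ℂ :=
  ![X 2 * X 1 ^ 3 - X 0 ^ 3 * X 1, 2 * X 0 * X 1 ^ 2 * X 2 + X 0 ^ 4,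
    -(3 * X 0 * X 1 ^ 3)]

/-- The line `ker L` is invariant by the foliation defined by the 1-form `Ω`:
`L` divides the coefficients of `Ω ∧ dL`. -/
def LineInv (Ω : Fin 3 → MvPolynomial (Fin 3) ℂ) (L : MvPolynomial (Fin 3) ℂ) : Prop :=
  L ∣ (Ω 0 * pderiv 1 L - Ω 1 * pderiv 0 L) ∧
  L ∣ (Ω 0 * pderiv 2 L - Ω 2 * pderiv 0 L) ∧
  L ∣ (Ω 1 * pderiv 2 L - Ω 2 * pderiv 1 L)

/-- The restriction of a polynomial to the affine line `t ↦ m + t·w` in the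
standard chart `x_k = 1`. -/
def lineRestrict (k : Fin 3) (m w : Fin 3 → ℂ) (P : MvPolynomial (Fin 3) ℂ) :
    Polynomial ℂ :=
  aeval (fun l => if l = k then 1 else Polynomial.C (m l) + Polynomial.C (w l) *
    Polynomial.X) P

/-- The tangency polynomial of the foliation `Ω` with the affine line `t ↦ m + t·w`
(in the chart `x_k = 1`): `t ↦ ω_{m+tw}(w)`.  Its order of vanishing at `t = 0` is the
tangency order `Tang(F, ℓ, m)` of the foliation with the line at `m`. -/
def tangPoly (Ω : Fin 3 → MvPolynomial (Fin 3) ℂ) (k : Fin 3) (m w : Fin 3 → ℂ) :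
    Polynomial ℂ :=
  ∑ l, Polynomial.C (w l) * lineRestrict k m w (Ω l)

/-- `subst3` as an algebra homomorphism. -/
def substHom (M : Matrix (Fin 3) (Fin 3) ℂ) :
    MvPolynomial (Fin 3) ℂ →ₐ[ℂ] MvPolynomial (Fin 3) ℂ :=
  aeval (fun i => ∑ j, C (M i j) * X j)

lemma subst3_eq (M : Matrix (Fin 3) (Fin 3) ℂ) (P : MvPolynomial (Fin 3) ℂ) :
    subst3 M P = substHom M P := rfl

lemma substHom_X (M : Matrix (Fin 3) (Fin 3) ℂ) (i : Fin 3) :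
    substHom M (X i) = ∑ j, C (M i j) * X j := by
  simp [substHom]

lemma substHom_C (M : Matrix (Fin 3) (Fin 3) ℂ) (a : ℂ) :
    substHom M (C a) = C a := by
  simp [substHom]

lemma substHom_mul (M N : Matrix (Fin 3) (Fin 3) ℂ) (P : MvPolynomial (Fin 3) ℂ) :
    substHom N (substHom M P) = substHom (M * N) P := by
  have : (substHom N).comp (substHom M) = substHom (M * N) := by
    apply MvPolynomial.algHom_ext
    intro i
    simp only [AlgHom.comp_apply, substHom_X, map_sum, map_mul, substHom_C]
    simp only [Matrix.mul_apply, Fin.sum_univ_three, map_add, map_mul]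
    ring
  exact DFunLike.congr_fun this P

lemma substHom_one (P : MvPolynomial (Fin 3) ℂ) : substHom 1 P = P := by
  have : substHom 1 = AlgHom.id ℂ _ := by
    apply MvPolynomial.algHom_ext
    intro i
    rw [substHom_X]
    simp [Matrix.one_apply, apply_ite C, ite_mul]
  rw [this]; rfl

lemma pb3_mul (M N : Matrix (Fin 3) (Fin 3) ℂ) (Ω : Fin 3 → MvPolynomial (Fin 3) ℂ) :
    pb3 N (pb3 M Ω) = pb3 (M * N) Ω := by
  funext i
  simp only [pb3, subst3_eq, map_sum, map_mul, substHom_C, substHom_mul]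
  simp only [Matrix.mul_apply, Fin.sum_univ_three, map_add, map_mul]
  ring

lemma pb3_one (Ω : Fin 3 → MvPolynomial (Fin 3) ℂ) : pb3 1 Ω = Ω := by
  funext i
  simp [pb3, subst3_eq, substHom_one, Matrix.one_apply, apply_ite C, ite_mul]

lemma pb3_smul (M : Matrix (Fin 3) (Fin 3) ℂ) (a : ℂ) (Ω : Fin 3 → MvPolynomial (Fin 3) ℂ) :
    pb3 M (fun i => C a * Ω i) = fun i => C a * pb3 M Ω i := by
  funext i
  simp only [pb3, subst3_eq, map_mul, substHom_C, Fin.sum_univ_three]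
  ring

lemma pb3_hom (M : Matrix (Fin 3) (Fin 3) ℂ) (Ω : Fin 3 → MvPolynomial (Fin 3) ℂ) (n : ℕ)
    (h : ∀ i, (Ω i).IsHomogeneous n) (i : Fin 3) : (pb3 M Ω i).IsHomogeneous n := by
  unfold pb3
  apply IsHomogeneous.sum
  intro j _
  rw [subst3]
  have h1 : (aeval (fun i => ∑ j, C (M i j) * X j) (Ω j) : MvPolynomial (Fin 3) ℂ).IsHomogeneous
      (1 * n) := by
    apply (h j).aeval
    intro i
    apply IsHomogeneous.sum
    intro j _
    simpa using (isHomogeneous_C (Fin 3) (M i j)).mul (isHomogeneous_X ℂ j)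
  simpa using (isHomogeneous_C (Fin 3) (M j i)).mul h1

lemma pb3_euler (M : Matrix (Fin 3) (Fin 3) ℂ) (Ω : Fin 3 → MvPolynomial (Fin 3) ℂ)
    (h : X 0 * Ω 0 + X 1 * Ω 1 + X 2 * Ω 2 = 0) :
    X 0 * pb3 M Ω 0 + X 1 * pb3 M Ω 1 + X 2 * pb3 M Ω 2 = 0 := by
  have := congrArg (substHom M) h
  simp only [map_add, map_mul, substHom_X, map_zero, Fin.sum_univ_three] at this
  simp only [pb3, subst3_eq, Fin.sum_univ_three]
  linear_combination this

lemma fol_conj (d : ℕ) (Ω Ω' : Fin 3 → MvPolynomial (Fin 3) ℂ) (hΩ : IsFolDeg d Ω)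
    (h : LinConj3 Ω Ω') : IsFolDeg d Ω' := by
  obtain ⟨N, c, hN, hc, hp⟩ := h
  obtain ⟨-, hh, he, hg⟩ := hΩ
  have hΩ' : Ω' = fun i => C c⁻¹ * pb3 N Ω i := by
    funext i
    rw [hp, ← mul_assoc, ← C_mul, inv_mul_cancel₀ hc]; simp
  have hgcd : ∀ h : MvPolynomial (Fin 3) ℂ, (∀ i, h ∣ Ω' i) → IsUnit h := by
    intro h hd
    have h1 : ∀ i, h ∣ pb3 N Ω i := fun i => by rw [hp]; exact (hd i).mul_left _
    have h2 : IsUnit (substHom N⁻¹ h) := by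
      apply hg
      intro i
      have : Ω = pb3 N⁻¹ (pb3 N Ω) := by
        rw [pb3_mul, Matrix.mul_nonsing_inv _ hN, pb3_one]
      rw [this]
      apply Finset.dvd_sum
      intro j _
      exact (map_dvd (substHom N⁻¹) (h1 j)).mul_left _
    have h3 := h2.map (substHom N)
    rwa [substHom_mul, Matrix.nonsing_inv_mul _ hN, substHom_one] at h3
  refine ⟨?_, ?_, ?_, hgcd⟩
  · rintro rfl
    exact (show Prime (X 0 : MvPolynomial (Fin 3) ℂ) from X_prime).not_isUnit (hgcd (X 0) (fun i => dvd_zero _))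
  · intro i
    rw [hΩ']
    simpa using (isHomogeneous_C (Fin 3) c⁻¹).mul (pb3_hom N Ω _ hh i)
  · rw [hΩ']
    linear_combination C c⁻¹ * pb3_euler N Ω he

lemma fol_F2 : IsFolDeg 3 OmF2 := by
  have hgcd : ∀ h : MvPolynomial (Fin 3) ℂ, (∀ i, h ∣ OmF2 i) → IsUnit h := by
    intro h hd
    have h0 := hd 0
    have h2 := hd 2
    simp only [OmF2, Matrix.cons_val] at h0 h2
    rw [dvd_neg] at h2
    have hp : Prime (X 0 : MvPolynomial (Fin 3) ℂ) := X_prime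
    obtain ⟨i, _, hi⟩ := (dvd_prime_pow hp 4).1 h2
    rcases Nat.eq_zero_or_pos i with rfl | hpos
    · exact hi.symm.isUnit (by simp)
    · exfalso
      have h3 : (X 0 : MvPolynomial (Fin 3) ℂ) ∣ h :=
        (dvd_pow_self _ hpos.ne').trans hi.symm.dvd
      have h4 : (X 0 : MvPolynomial (Fin 3) ℂ) ∣ X 1 ^ 4 := by
        have h5 : (X 0 : MvPolynomial (Fin 3) ℂ) ∣ X 2 * X 0 ^ 3 :=
          (dvd_pow_self _ (by norm_num)).mul_left _
        exact (dvd_sub_right h5).1 (h3.trans h0)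
      have h6 := hp.dvd_of_dvd_pow h4
      rw [X_dvd_X] at h6
      simp at h6
  have hX : ∀ i : Fin 3, (X i : MvPolynomial (Fin 3) ℂ).IsHomogeneous 1 := isHomogeneous_X ℂ
  refine ⟨?_, ?_, ?_, hgcd⟩
  · intro h0
    rw [h0] at hgcd
    exact (show Prime (X 0 : MvPolynomial (Fin 3) ℂ) from X_prime).not_isUnit (hgcd (X 0) (fun i => dvd_zero _))
  · intro i
    fin_cases i
    · exact ((hX 2).mul ((hX 0).pow 3)).sub ((hX 1).pow 4)
    · exact (hX 0).mul ((hX 1).pow 3)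
    · exact ((hX 0).pow 4).neg
  · simp only [OmF2, Matrix.cons_val]
    ring

/-- The exponent vector `(a,b,c)`. -/
def ex (a b c : ℕ) : Fin 3 →₀ ℕ := Finsupp.equivFunOnFinite.symm ![a, b, c]

lemma ex_eq (s : Fin 3 →₀ ℕ) : s = ex (s 0) (s 1) (s 2) := by
  ext i; fin_cases i <;> simp [ex]

lemma ex_inj {a b c a' b' c' : ℕ} : ex a b c = ex a' b' c' ↔ a = a' ∧ b = b' ∧ c = c' := by
  constructor
  · intro h
    have h0 := DFunLike.congr_fun h 0
    have h1 := DFunLike.congr_fun h 1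
    have h2 := DFunLike.congr_fun h 2
    simp [ex] at h0 h1 h2
    exact ⟨h0, h1, h2⟩
  · rintro ⟨rfl, rfl, rfl⟩; rfl

lemma deg_of_coeff {P : MvPolynomial (Fin 3) ℂ} {n : ℕ} (hP : P.IsHomogeneous n)
    {s : Fin 3 →₀ ℕ} (h : coeff s P ≠ 0) : s 0 + s 1 + s 2 = n := by
  have := hP h
  rw [Finsupp.weight_apply, Finsupp.sum_fintype _ _ (by simp)] at this
  simpa [Fin.sum_univ_three] using this

lemma coeff_restrict {P : MvPolynomial (Fin 3) ℂ} (hP : P.IsHomogeneous 4) (n : ℕ) (hn : n ≤ 4) :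
    (aeval ![0, Polynomial.X, 1] P : Polynomial ℂ).coeff n = coeff (ex 0 n (4 - n)) P := by
  conv_lhs => rw [P.as_sum]
  rw [map_sum, Polynomial.finsetSum_coeff]
  have key : ∀ s ∈ P.support, (aeval ![0, Polynomial.X, 1] (monomial s (coeff s P)) :
      Polynomial ℂ).coeff n = if s = ex 0 n (4 - n) then coeff s P else 0 := by
    intro s hs
    have hd := deg_of_coeff hP (mem_support_iff.1 hs)
    rw [aeval_monomial, Finsupp.prod_fintype _ _ (by simp)]
    simp only [Fin.prod_univ_three, Matrix.cons_val, one_pow, mul_one]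
    rw [Polynomial.algebraMap_eq, Polynomial.coeff_C_mul]
    have hiff : s = ex 0 n (4 - n) ↔ s 0 = 0 ∧ n = s 1 := by
      conv_lhs => rw [ex_eq s]
      rw [ex_inj]; omega
    by_cases h0 : s 0 = 0
    · simp only [hiff, h0, pow_zero, one_mul, Polynomial.coeff_X_pow, true_and]
      simp
    · simp [hiff, h0]
  rw [Finset.sum_congr rfl key, Finset.sum_ite_eq']
  split_ifs with h
  · rfl
  · exact (notMem_support_iff.1 h).symm

lemma coeff_lin (φ : MvPolynomial (Fin 3) ℂ →ₗ[ℂ] MvPolynomial (Fin 3) ℂ)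
    (F : Finset (Fin 3 →₀ ℕ)) (P : MvPolynomial (Fin 3) ℂ) (hP : P.support ⊆ F)
    (n : Fin 3 →₀ ℕ) :
    coeff n (φ P) = ∑ s ∈ F, coeff s P * coeff n (φ (monomial s 1)) := by
  have h : P = ∑ s ∈ F, (coeff s P) • monomial s (1 : ℂ) := by
    conv_lhs => rw [P.as_sum]
    rw [← Finset.sum_subset hP]
    · simp [smul_monomial]
    · intro s _ hs
      rw [notMem_support_iff.1 hs, zero_smul]
  conv_lhs => rw [h]
  simp [coeff_sum]

/-- Degree-4 exponents. -/
lemma tendsto_lin {P : ℂ → MvPolynomial (Fin 3) ℂ} {L : MvPolynomial (Fin 3) ℂ}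
    {l : Filter ℂ} (F : Finset (Fin 3 →₀ ℕ)) (hP : ∀ e, (P e).support ⊆ F) (hL : L.support ⊆ F)
    (h : ∀ s, Filter.Tendsto (fun e => coeff s (P e)) l (nhds (coeff s L)))
    (φ : MvPolynomial (Fin 3) ℂ →ₗ[ℂ] MvPolynomial (Fin 3) ℂ) (n : Fin 3 →₀ ℕ) :
    Filter.Tendsto (fun e => coeff n (φ (P e))) l (nhds (coeff n (φ L))) := by
  rw [coeff_lin φ F L hL]
  simp only [fun e => coeff_lin φ F (P e) (hP e) n]
  exact tendsto_finsetSum _ fun s _ => (h s).mul_const _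

/-- Diagonal matrix of weights `(4,1,0)`. -/
def Dg (e : ℂ) : Matrix (Fin 3) (Fin 3) ℂ := Matrix.diagonal ![e ^ 4, e, 1]

lemma coeff_Dg (e : ℂ) (P : MvPolynomial (Fin 3) ℂ) (s : Fin 3 →₀ ℕ) :
    coeff s (substHom (Dg e) P) = e ^ (4 * s 0 + s 1) * coeff s P := by
  induction P using MvPolynomial.induction_on' with
  | monomial t a =>
    have : substHom (Dg e) (monomial t a) = monomial t (e ^ (4 * t 0 + t 1) * a) := by
      rw [monomial_eq, monomial_eq, map_mul, substHom_C, Finsupp.prod_fintype _ _ (by simp),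
        map_prod]
      simp only [map_pow, substHom_X, Fin.prod_univ_three, Fin.sum_univ_three, Dg,
        Matrix.diagonal_apply, Matrix.cons_val]
      simp [mul_pow]
      ring
    rw [this, coeff_monomial, coeff_monomial]
    split_ifs with h
    · rw [h]
    · simp
  | add p q hp hq => rw [map_add, coeff_add, coeff_add, hp, hq]; ring

lemma coeff_pbDg (e : ℂ) (Ψ : Fin 3 → MvPolynomial (Fin 3) ℂ) (i : Fin 3) (s : Fin 3 →₀ ℕ) :
    coeff s (pb3 (Dg e) Ψ i) = e ^ (4 * s 0 + s 1 + (![4, 1, 0] : Fin 3 → ℕ) i) * coeff s (Ψ i) := by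
  simp only [pb3, subst3_eq, Fin.sum_univ_three, coeff_add, coeff_C_mul, coeff_Dg]
  fin_cases i <;> simp [Dg] <;> ring

/-- The limit form. -/
def Lim (a c : ℂ) : Fin 3 → MvPolynomial (Fin 3) ℂ :=
  ![monomial (ex 0 0 4) a, monomial (ex 0 3 1) c, monomial (ex 1 0 3) (-a) + monomial (ex 0 4 0) (-c)]

lemma mon_ex (i j k : ℕ) (a : ℂ) : monomial (ex i j k) a = C a * X 0 ^ i * X 1 ^ j * X 2 ^ k := by
  rw [monomial_eq, Finsupp.prod_fintype _ _ (by simp), Fin.prod_univ_three]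
  simp [ex, mul_assoc]

/-- The conjugating matrix. -/
def Sm (r : ℂ) : Matrix (Fin 3) (Fin 3) ℂ := !![0, 0, 1; 0, 1, 0; r, 0, 0]

lemma Lim_eq (a c : ℂ) (hc : c ≠ 0) : Lim a c = fun i => C c * pb3 (Sm (-a / c)) OmF2 i := by
  have hr : (C a : MvPolynomial (Fin 3) ℂ) = - (C c * C (-a / c)) := by
    rw [← C_mul, ← C_neg]; congr 1; field_simp
  generalize -a / c = r at hr
  funext i
  simp only [pb3, subst3_eq, Fin.sum_univ_three]
  fin_cases i <;> simp [Lim, mon_ex, OmF2, Sm, substHom_X, Fin.sum_univ_three, hr] <;> ring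

lemma lim_coeff (Ψ : Fin 3 → MvPolynomial (Fin 3) ℂ) (hh : ∀ i, (Ψ i).IsHomogeneous 4)
    (he : X 0 * Ψ 0 + X 1 * Ψ 1 + X 2 * Ψ 2 = 0)
    (h1 : ∀ n < 3, coeff (ex 0 n (4 - n)) (Ψ 1) = 0) (i : Fin 3) (s : Fin 3 →₀ ℕ) :
    let a := coeff (ex 0 0 4) (Ψ 0)
    let c := coeff (ex 0 3 1) (Ψ 1)
    (4 * s 0 + s 1 + (![4, 1, 0] : Fin 3 → ℕ) i = 4 ∧ coeff s (Lim a c i) = coeff s (Ψ i)) ∨ (4 < 4 * s 0 + s 1 + (![4, 1, 0] : Fin 3 → ℕ) i ∧ coeff s (Lim a c i) = 0) ∨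
      (coeff s (Ψ i) = 0 ∧ coeff s (Lim a c i) = 0) := by
  intro a c
  have hX : ∀ (x y z : ℕ) (P : MvPolynomial (Fin 3) ℂ),
      coeff (ex x y z) (X 0 * P) = if x = 0 then 0 else coeff (ex (x - 1) y z) P := by
    intro x y z P
    rw [coeff_X_mul']
    rcases Nat.eq_zero_or_pos x with rfl | hx
    · simp [ex]
    · have : ex x y z - Finsupp.single 0 1 = ex (x - 1) y z := by
        ext i; fin_cases i <;> simp [ex]
      rw [this]; simp [ex, hx.ne']
  have hY : ∀ (x y z : ℕ) (P : MvPolynomial (Fin 3) ℂ),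
      coeff (ex x y z) (X 1 * P) = if y = 0 then 0 else coeff (ex x (y - 1) z) P := by
    intro x y z P
    rw [coeff_X_mul']
    rcases Nat.eq_zero_or_pos y with rfl | hx
    · simp [ex]
    · have : ex x y z - Finsupp.single 1 1 = ex x (y - 1) z := by
        ext i; fin_cases i <;> simp [ex]
      rw [this]; simp [ex, hx.ne']
  have hZ : ∀ (x y z : ℕ) (P : MvPolynomial (Fin 3) ℂ),
      coeff (ex x y z) (X 2 * P) = if z = 0 then 0 else coeff (ex x y (z - 1)) P := by
    intro x y z P
    rw [coeff_X_mul']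
    rcases Nat.eq_zero_or_pos z with rfl | hx
    · simp [ex]
    · have : ex x y z - Finsupp.single 2 1 = ex x y (z - 1) := by
        ext i; fin_cases i <;> simp [ex]
      rw [this]; simp [ex, hx.ne']
  have eul : ∀ x y z, coeff (ex x y z) (X 0 * Ψ 0) + coeff (ex x y z) (X 1 * Ψ 1)
      + coeff (ex x y z) (X 2 * Ψ 2) = 0 := by
    intro x y z
    rw [← coeff_add, ← coeff_add, he, coeff_zero]
  simp only [hX, hY, hZ] at eul
  have e0 := eul 0 0 5
  have e1 := eul 0 1 4
  have e2 := eul 0 2 3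
  have e3 := eul 0 3 2
  have e4 := eul 0 4 1
  have e5 := eul 1 0 4
  have f0 := h1 0 (by norm_num)
  have f1 := h1 1 (by norm_num)
  have f2 := h1 2 (by norm_num)
  norm_num at e0 e1 e2 e3 e4 e5 f0 f1 f2
  rw [f0, zero_add] at e1
  rw [f1, zero_add] at e2
  rw [f2, zero_add] at e3
  have hs : s 0 + s 1 + s 2 ≠ 4 → coeff s (Ψ i) = 0 := by
    intro h; by_contra h'; exact h (deg_of_coeff (hh i) h')
  obtain ⟨x, y, z, rfl⟩ : ∃ x y z, s = ex x y z := ⟨_, _, _, ex_eq s⟩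
  have q0 : (ex x y z) 0 = x := by simp [ex]
  have q1 : (ex x y z) 1 = y := by simp [ex]
  have q2 : (ex x y z) 2 = z := by simp [ex]
  simp only [q0, q1, q2] at hs ⊢
  clear q0 q1 q2
  have c0 : coeff (ex x y z) (Lim a c 0) = if 0 = x ∧ 0 = y ∧ 4 = z then a else 0 := by
    simp [Lim, coeff_monomial, ex_inj]
  have c1 : coeff (ex x y z) (Lim a c 1) = if 0 = x ∧ 3 = y ∧ 1 = z then c else 0 := by
    simp [Lim, coeff_monomial, ex_inj]
  have c2 : coeff (ex x y z) (Lim a c 2) = (if 1 = x ∧ 0 = y ∧ 3 = z then -a else 0)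
      + if 0 = x ∧ 4 = y ∧ 0 = z then -c else 0 := by
    simp only [Lim, Matrix.cons_val, coeff_add, coeff_monomial, ex_inj]
  by_cases hd : x + y + z = 4
  swap
  · right; right
    refine ⟨hs hd, ?_⟩
    obtain rfl | rfl | rfl : i = 0 ∨ i = 1 ∨ i = 2 := by fin_cases i <;> simp
    · exact c0.trans (if_neg (by omega))
    · exact c1.trans (if_neg (by omega))
    · refine c2.trans ?_
      rw [if_neg (by omega), if_neg (by omega), add_zero]
  clear hs hX hY hZ eul h1
  by_cases hE : 4 < 4 * x + y + (![4, 1, 0] : Fin 3 → ℕ) i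
  · right; left
    refine ⟨hE, ?_⟩
    obtain rfl | rfl | rfl : i = 0 ∨ i = 1 ∨ i = 2 := by fin_cases i <;> simp
    · simp at hE
      exact c0.trans (if_neg (by omega))
    · simp at hE
      exact c1.trans (if_neg (by omega))
    · simp at hE
      refine c2.trans ?_
      rw [if_neg (by omega), if_neg (by omega), add_zero]
  obtain rfl | rfl | rfl : i = 0 ∨ i = 1 ∨ i = 2 := by fin_cases i <;> simp
  · simp at hE
    obtain ⟨rfl, rfl, rfl⟩ : x = 0 ∧ y = 0 ∧ z = 4 := by omega
    left
    exact ⟨by simp, c0.trans (by simp [a])⟩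
  · simp at hE
    obtain rfl : x = 0 := by omega
    obtain rfl : z = 4 - y := by omega
    obtain h | h | h | h : y = 0 ∨ y = 1 ∨ y = 2 ∨ y = 3 := by omega
    · subst h; right; right; exact ⟨f0, c1.trans (by simp)⟩
    · subst h; right; right; exact ⟨f1, c1.trans (by simp)⟩
    · subst h; right; right; exact ⟨f2, c1.trans (by simp)⟩
    · subst h; left; exact ⟨by simp, c1.trans (by simp [c])⟩
  · simp at hE
    rcases Nat.eq_zero_or_pos x with rfl | hx
    · obtain rfl : z = 4 - y := by omega
      obtain h | h | h | h | h : y = 0 ∨ y = 1 ∨ y = 2 ∨ y = 3 ∨ y = 4 := by omega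
      · subst h; right; right; exact ⟨e0, c2.trans (by simp)⟩
      · subst h; right; right; exact ⟨e1, c2.trans (by simp)⟩
      · subst h; right; right; exact ⟨e2, c2.trans (by simp)⟩
      · subst h; right; right; exact ⟨e3, c2.trans (by simp)⟩
      · subst h; left
        refine ⟨by simp, c2.trans ?_⟩
        simp only [c]
        norm_num
        linear_combination -e4
    · obtain ⟨rfl, rfl, rfl⟩ : x = 1 ∧ y = 0 ∧ z = 3 := by omega
      left
      refine ⟨by simp, c2.trans ?_⟩
      simp only [a]
      norm_num
      linear_combination -e5

/-- Component of the pullback as a linear map in each component. -/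
lemma tendsto_pb {P : ℂ → Fin 3 → MvPolynomial (Fin 3) ℂ} {L : Fin 3 → MvPolynomial (Fin 3) ℂ}
    {l : Filter ℂ} (F : Finset (Fin 3 →₀ ℕ)) (hP : ∀ e i, (P e i).support ⊆ F)
    (hL : ∀ i, (L i).support ⊆ F)
    (h : ∀ i s, Filter.Tendsto (fun e => coeff s (P e i)) l (nhds (coeff s (L i))))
    (Q : Matrix (Fin 3) (Fin 3) ℂ) (i : Fin 3) (n : Fin 3 →₀ ℕ) :
    Filter.Tendsto (fun e => coeff n (pb3 Q (P e) i)) l (nhds (coeff n (pb3 Q L i))) := by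
  simp only [pb3, subst3_eq, coeff_sum, coeff_C_mul]
  apply tendsto_finsetSum
  intro j _
  apply Filter.Tendsto.const_mul
  exact tendsto_lin F (fun e => hP e j) (hL j) (h j) (substHom Q).toLinearMap n

lemma main_lim (Ω : Fin 3 → MvPolynomial (Fin 3) ℂ) (M : Matrix (Fin 3) (Fin 3) ℂ)
    (hM : IsUnit M.det) (hh : ∀ i, (pb3 M Ω i).IsHomogeneous 4)
    (he : X 0 * pb3 M Ω 0 + X 1 * pb3 M Ω 1 + X 2 * pb3 M Ω 2 = 0)
    (h1 : ∀ n < 3, coeff (ex 0 n (4 - n)) (pb3 M Ω 1) = 0)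
    (ha : coeff (ex 0 0 4) (pb3 M Ω 0) ≠ 0) (hc : coeff (ex 0 3 1) (pb3 M Ω 1) ≠ 0)
    (Ω' : Fin 3 → MvPolynomial (Fin 3) ℂ) (hΩ' : LinConj3 OmF2 Ω') :
    coeffs Ω' ∈ closure (coeffs '' OrbitOf Ω) := by
  have key := lim_coeff (pb3 M Ω) hh he h1
  obtain ⟨N, c', hN, hc', hp⟩ := hΩ'
  set Ψ := pb3 M Ω with hΨ
  set a := coeff (ex 0 0 4) (Ψ 0)
  set c := coeff (ex 0 3 1) (Ψ 1)
  have hS : IsUnit (Sm (-a / c)).det := by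
    rw [isUnit_iff_ne_zero, Matrix.det_fin_three]
    simp [Sm, ha, hc]
  set S := Sm (-a / c) with hSdef
  set Q := S⁻¹ * N with hQ
  have hQd : IsUnit Q.det := by
    rw [hQ, Matrix.det_mul]
    exact (Matrix.isUnit_nonsing_inv_det S hS).mul hN
  have hLQ : pb3 Q (Lim a c) = fun i => C (c * c') * Ω' i := by
    rw [Lim_eq a c hc, pb3_smul, pb3_mul, hQ, ← mul_assoc, ← hSdef, Matrix.mul_nonsing_inv _ hS,
      one_mul, hp]
    funext i
    rw [C_mul, mul_assoc]
  let F : Finset (Fin 3 →₀ ℕ) := Finset.univ.biUnion (fun i => (Ψ i).support) ∪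
    Finset.univ.biUnion (fun i => (Lim a c i).support)
  let P : ℂ → Fin 3 → MvPolynomial (Fin 3) ℂ := fun e i => C ((e ^ 4)⁻¹) * pb3 (Dg e) Ψ i
  have hPF : ∀ e i, (P e i).support ⊆ F := by
    intro e i s hs
    apply Finset.mem_union_left
    rw [Finset.mem_biUnion]
    refine ⟨i, Finset.mem_univ _, ?_⟩
    rw [mem_support_iff] at hs ⊢
    intro h0
    apply hs
    simp only [P, coeff_C_mul, coeff_pbDg, h0, mul_zero]
  have hLF : ∀ i, (Lim a c i).support ⊆ F := by
    intro i s hs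
    apply Finset.mem_union_right
    rw [Finset.mem_biUnion]
    exact ⟨i, Finset.mem_univ _, hs⟩
  have hne : ∀ᶠ e : ℂ in nhdsWithin 0 {0}ᶜ, e ≠ 0 := eventually_mem_nhdsWithin
  have hlim : ∀ i s, Filter.Tendsto (fun e => coeff s (P e i)) (nhdsWithin 0 {0}ᶜ)
      (nhds (coeff s (Lim a c i))) := by
    intro i s
    simp only [P, coeff_C_mul, coeff_pbDg]
    obtain ⟨hE, hk⟩ | ⟨hE, hk⟩ | ⟨h0, hk⟩ := key i s
    · rw [hE, hk]
      refine tendsto_const_nhds.congr' ?_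
      filter_upwards [hne] with e he
      field_simp
    · rw [hk]
      generalize 4 * s 0 + s 1 + (![4, 1, 0] : Fin 3 → ℕ) i = E at hE
      have : Filter.Tendsto (fun e : ℂ => e ^ (E - 4) * coeff s (Ψ i)) (nhdsWithin 0 {0}ᶜ)
          (nhds 0) := by
        have h2 : Continuous (fun e : ℂ => e ^ (E - 4) * coeff s (Ψ i)) := by fun_prop
        have h3 := h2.tendsto 0
        rw [zero_pow (by omega), zero_mul] at h3
        exact h3.mono_left nhdsWithin_le_nhds
      refine this.congr' ?_
      filter_upwards [hne] with e he
      obtain ⟨t, rfl⟩ : ∃ t, E = 4 + t := ⟨E - 4, by omega⟩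
      rw [Nat.add_sub_cancel_left, pow_add]
      field_simp
    · simp [h0, hk]
  have hcc : c * c' ≠ 0 := mul_ne_zero hc hc'
  let G : ℂ → Fin 3 → MvPolynomial (Fin 3) ℂ := fun e i => C ((c * c')⁻¹) * pb3 Q (P e) i
  have hG : Filter.Tendsto (fun e => coeffs (G e)) (nhdsWithin 0 {0}ᶜ) (nhds (coeffs Ω')) := by
    rw [tendsto_pi_nhds]; intro i
    rw [tendsto_pi_nhds]; intro n
    have h5 := (tendsto_pb F hPF hLF hlim Q i n).const_mul ((c * c')⁻¹)
    rw [hLQ] at h5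
    simp only [coeff_C_mul] at h5
    rw [inv_mul_cancel_left₀ hcc] at h5
    simpa only [_root_.coeffs, G, coeff_C_mul] using h5
  refine mem_closure_of_tendsto hG ?_
  filter_upwards [hne] with e he0
  refine ⟨G e, ⟨M * Dg e * Q, c * c' * e ^ 4, ?_, by positivity, ?_⟩, rfl⟩
  · rw [Matrix.det_mul, Matrix.det_mul]
    refine (hM.mul ?_).mul hQd
    rw [isUnit_iff_ne_zero, Dg, Matrix.det_diagonal, Fin.prod_univ_three]
    simp [he0]
  · funext i
    simp only [G, P, pb3_smul, hΨ, pb3_mul]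
    rw [← mul_assoc, ← mul_assoc, ← C_mul, ← mul_assoc, ← C_mul]
    have : c * c' * e ^ 4 * (c * c')⁻¹ * (e ^ 4)⁻¹ = 1 := by field_simp
    rw [this, C_1, one_mul]

/-- **Sufficient condition for degenerating onto `F₂`.**
Let `F` be a degree-3 foliation of `ℙ²(ℂ)`, not linearly conjugate to `F₂`.
Suppose `F` has a double inflection point: a nonsingular point `m` such that the
tangent line of `F` at `m` has contact of order exactly 3 with the leaf through `m`,
i.e. (in a standard affine chart containing `m`) there is a tangent direction `w` at
`m` whose tangency polynomial vanishes at `t = 0` to order exactly 3.  Then `F`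
degenerates onto `F₂`: `O(F₂)` is contained in the closure of `O(F)` in `F(3)`. -/
theorem stmt_15 (Ω : Fin 3 → MvPolynomial (Fin 3) ℂ)
    (hfol : IsFolDeg 3 Ω)
    (hnc : ¬ LinConj3 Ω OmF2)
    (hm : ∃ (i j k : Fin 3) (m : Fin 3 → ℂ), i ≠ j ∧ i ≠ k ∧ j ≠ k ∧ m k = 1 ∧
      (eval m (Ω i) ≠ 0 ∨ eval m (Ω j) ≠ 0) ∧
      ∃ w : Fin 3 → ℂ, w ≠ 0 ∧ w k = 0 ∧ (∑ l, w l * eval m (Ω l)) = 0 ∧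
        Polynomial.X ^ 3 ∣ tangPoly Ω k m w ∧
        ¬ Polynomial.X ^ 4 ∣ tangPoly Ω k m w) :
    OrbitOf OmF2 ⊆ FClos 3 (OrbitOf Ω) := by
  intro Ω' hΩ'
  refine ⟨fol_conj 3 _ _ fol_F2 hΩ', ?_⟩
  obtain ⟨-, hh, he, -⟩ := hfol
  obtain ⟨i, j, k, m, hij, hik, hjk, hmk, hns, w, hw, hwk, hwt, h3, h4⟩ := hm
  obtain ⟨l, hl⟩ : ∃ l, eval m (Ω l) ≠ 0 := by
    rcases hns with h | h
    · exact ⟨_, h⟩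
    · exact ⟨_, h⟩
  have hem := congrArg (eval m) he
  simp only [map_add, map_mul, eval_X, map_zero] at hem
  let u : Fin 3 → ℂ := Pi.single l 1
  have hu : ∑ p, u p * eval m (Ω p) = eval m (Ω l) := by simp [u, Pi.single_apply]
  let M : Matrix (Fin 3) (Fin 3) ℂ := Matrix.of fun p => ![u p, w p, m p]
  have hM0 : ∀ p, M p 0 = u p := fun p => rfl
  have hM1 : ∀ p, M p 1 = w p := fun p => rfl
  have hM2 : ∀ p, M p 2 = m p := fun p => rfl
  have hMd : IsUnit M.det := by
    rw [isUnit_iff_ne_zero]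
    intro h0
    obtain ⟨v, hv, hMv⟩ := Matrix.exists_mulVec_eq_zero_iff.2 h0
    have hMv' : ∀ p, u p * v 0 + w p * v 1 + m p * v 2 = 0 := by
      intro p
      have := congrFun hMv p
      simpa [Matrix.mulVec, dotProduct, Fin.sum_univ_three, hM0, hM1, hM2] using this
    rw [Fin.sum_univ_three] at hu hwt
    have hv0 : v 0 = 0 := by
      have : v 0 * eval m (Ω l) = 0 := by
        rw [← hu]
        linear_combination eval m (Ω 0) * hMv' 0 + eval m (Ω 1) * hMv' 1 + eval m (Ω 2) * hMv' 2
          - v 1 * hwt - v 2 * hem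
      exact (mul_eq_zero.1 this).resolve_right hl
    have hv2 : v 2 = 0 := by
      have := hMv' k
      rw [hv0, hwk, hmk] at this
      simpa using this
    have hv1 : v 1 ≠ 0 := by
      intro hv1
      apply hv
      funext q
      fin_cases q
      · exact hv0
      · exact hv1
      · exact hv2
    apply hw
    funext p
    have := hMv' p
    rw [hv0, hv2] at this
    simpa [hv1] using this
  have hH := pb3_hom M Ω 4 hh
  have hres : ∀ q, (aeval ![0, Polynomial.X, 1] (pb3 M Ω q) : Polynomial ℂ)
      = ∑ p, Polynomial.C (M p q) * lineRestrict k m w (Ω p) := by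
    intro q
    have hcomp : (aeval ![0, Polynomial.X, 1] : MvPolynomial (Fin 3) ℂ →ₐ[ℂ] Polynomial ℂ).comp
        (substHom M) = aeval (fun l => if l = k then 1 else Polynomial.C (m l) +
          Polynomial.C (w l) * Polynomial.X) := by
      apply MvPolynomial.algHom_ext
      intro p
      simp only [AlgHom.comp_apply, substHom_X, Fin.sum_univ_three, map_add, map_mul, aeval_X,
        aeval_C, hM0, hM1, hM2, Matrix.cons_val, Polynomial.algebraMap_eq]
      split_ifs with hpk
      · subst hpk; simp [hwk, hmk]
      · ring
    simp only [pb3, subst3_eq, map_sum, map_mul, aeval_C, Polynomial.algebraMap_eq]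
    refine Finset.sum_congr rfl fun p _ => ?_
    congr 1
    exact DFunLike.congr_fun hcomp (Ω p)
  have ht : (aeval ![0, Polynomial.X, 1] (pb3 M Ω 1) : Polynomial ℂ) = tangPoly Ω k m w := hres 1
  rw [Polynomial.X_pow_dvd_iff] at h3
  have h1 : ∀ n < 3, coeff (ex 0 n (4 - n)) (pb3 M Ω 1) = 0 := by
    intro n hn
    rw [← coeff_restrict (hH 1) n (by omega), ht]
    exact h3 n hn
  refine main_lim Ω M hMd hH (pb3_euler M Ω he) h1 ?_ ?_ Ω' hΩ'
  · rw [← coeff_restrict (hH 0) 0 (by omega), hres 0, Polynomial.coeff_zero_eq_eval_zero,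
      Polynomial.eval_finsetSum]
    have hev : ∀ P, Polynomial.eval 0 (lineRestrict k m w P) = eval m P := by
      intro P
      have hcomp : (Polynomial.aeval (0 : ℂ)).comp (aeval (fun l => if l = k then 1 else
          Polynomial.C (m l) + Polynomial.C (w l) * Polynomial.X) :
            MvPolynomial (Fin 3) ℂ →ₐ[ℂ] Polynomial ℂ) = aeval m := by
        apply MvPolynomial.algHom_ext
        intro p
        simp only [AlgHom.comp_apply, aeval_X]
        split_ifs with hpk
        · subst hpk; simp [hmk]
        · simp
      have := DFunLike.congr_fun hcomp P
      simpa [lineRestrict, Polynomial.coe_aeval_eq_eval, MvPolynomial.aeval_eq_eval] using this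
    simp only [Polynomial.eval_mul, Polynomial.eval_C, hev, hM0]
    rw [hu]; exact hl
  · intro h0
    apply h4
    rw [Polynomial.X_pow_dvd_iff]
    intro n hn
    rcases Nat.lt_succ_iff_lt_or_eq.1 hn with h | rfl
    · exact h3 n h
    · rw [← ht, coeff_restrict (hH 1) 3 (by omega)]
      exact h0
end
end

section
/- Let F be a degree-3 foliation of ℙ²(ℂ). If F degenerates onto the foliation F₂ given in the chart z = 1 by ω̄₂ = x³dx + y³(x dy − y dx) — i.e. O(F₂) ⊆ closure(O(F)) in F(3) and O(F) ≠ O(F₂) — then deg I^tr_F ≥ 2, where I^tr_F is the transverse part of the inflection divisor of F: the extactic polynomial E of F divided by the product, over all F-invariant linear forms L, of L raised to its multiplicity in E. -/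
open MvPolynomial

noncomputable section

/-- The derivation associated to the homogeneous vector field
`Z = A ∂x + B ∂y + C ∂z`. -/
def Zop (A B Cz f : MvPolynomial (Fin 3) ℂ) : MvPolynomial (Fin 3) ℂ :=
  A * pderiv 0 f + B * pderiv 1 f + Cz * pderiv 2 f

/-- The extactic polynomial of the vector field `Z = A ∂x + B ∂y + C ∂z`, cutting out
the inflection divisor of the associated foliation. -/
def extactic (A B Cz : MvPolynomial (Fin 3) ℂ) : MvPolynomial (Fin 3) ℂ :=
  Matrix.det
    !![X 0, Zop A B Cz (X 0), Zop A B Cz (Zop A B Cz (X 0));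
       X 1, Zop A B Cz (X 1), Zop A B Cz (Zop A B Cz (X 1));
       X 2, Zop A B Cz (X 2), Zop A B Cz (Zop A B Cz (X 2))]

/-- The line `ker L` is invariant by the foliation defined by `Z`: `L ∣ Z(L)`. -/
def LineInvZ (A B Cz L : MvPolynomial (Fin 3) ℂ) : Prop :=
  L ∣ Zop A B Cz L

/-- The projective 1-form `i_R i_Z (dx ∧ dy ∧ dz)` of the foliation defined by the
vector field `Z = A ∂x + B ∂y + C ∂z`. -/
def OmZ (A B Cz : MvPolynomial (Fin 3) ℂ) : Fin 3 → MvPolynomial (Fin 3) ℂ :=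
  ![X 2 * B - X 1 * Cz, X 0 * Cz - X 2 * A, X 1 * A - X 0 * B]

/-- Linear form with coefficient vector `v`. -/
def linF (v : Fin 3 → ℂ) : MvPolynomial (Fin 3) ℂ := ∑ j, C (v j) * X j

/-- Auxiliary covariant. -/
def KF (Ω : Fin 3 → MvPolynomial (Fin 3) ℂ) : MvPolynomial (Fin 3) ℂ :=
  Ω 0 * (-Ω 1 * pderiv 0 (Ω 1) + Ω 0 * pderiv 1 (Ω 1))
    - Ω 1 * (-Ω 1 * pderiv 0 (Ω 0) + Ω 0 * pderiv 1 (Ω 0))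

/-- Pulled-back vector field. -/
def ZP (M : Matrix (Fin 3) (Fin 3) ℂ) (A B Cz : MvPolynomial (Fin 3) ℂ) (i : Fin 3) :
    MvPolynomial (Fin 3) ℂ :=
  C (M.adjugate i 0) * subst3 M A + C (M.adjugate i 1) * subst3 M B
    + C (M.adjugate i 2) * subst3 M Cz

theorem linF_hom (v : Fin 3 → ℂ) : (linF v).IsHomogeneous 1 := by
  refine IsHomogeneous.sum _ _ _ (fun i _ => ?_)
  simpa using (isHomogeneous_C (Fin 3) (v i)).mul (isHomogeneous_X ℂ i)

theorem subst3_hom (M : Matrix (Fin 3) (Fin 3) ℂ) {P : MvPolynomial (Fin 3) ℂ} {n : ℕ}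
    (h : P.IsHomogeneous n) : (subst3 M P).IsHomogeneous n := by
  have := h.aeval (fun i => ∑ j, C (M i j) * X j : Fin 3 → MvPolynomial (Fin 3) ℂ) (n := 1)
    (fun i => linF_hom (M i))
  simpa [subst3] using this

theorem hom1_eq {f : MvPolynomial (Fin 3) ℂ} (h : f.IsHomogeneous 1) :
    ∃ v, f = linF v := by
  refine ⟨fun i => coeff (Finsupp.single i 1) f, ?_⟩
  ext m
  by_cases hm : m.degree = 1
  · obtain ⟨i, rfl⟩ : ∃ i, m = Finsupp.single i 1 := by
      have hs : m 0 + m 1 + m 2 = 1 := by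
        rw [← hm, Finsupp.degree_eq_sum, Fin.sum_univ_three]
      have : m 0 = 1 ∧ m 1 = 0 ∧ m 2 = 0 ∨ m 0 = 0 ∧ m 1 = 1 ∧ m 2 = 0 ∨
        m 0 = 0 ∧ m 1 = 0 ∧ m 2 = 1 := by omega
      rcases this with h | h | h
      · exact ⟨0, by ext i; fin_cases i <;> simp [h]⟩
      · exact ⟨1, by ext i; fin_cases i <;> simp [h]⟩
      · exact ⟨2, by ext i; fin_cases i <;> simp [h]⟩
    simp [linF, coeff_sum, coeff_C_mul, coeff_X, Finsupp.single_left_inj]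
  · rw [h.coeff_eq_zero hm, (linF_hom _).coeff_eq_zero hm]

theorem subst3_linF (M : Matrix (Fin 3) (Fin 3) ℂ) (v : Fin 3 → ℂ) :
    subst3 M (linF v) = linF (Matrix.vecMul v M) := by
  simp [subst3, linF, Fin.sum_univ_three, Matrix.vecMul, dotProduct]
  ring

theorem aff_eq {f : MvPolynomial (Fin 3) ℂ} (h : f.totalDegree ≤ 1) :
    ∃ a v, f = C a + linF v := by
  obtain ⟨v, hv⟩ := hom1_eq (homogeneousComponent_isHomogeneous 1 f)
  refine ⟨coeff 0 f, v, ?_⟩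
  rw [← hv, ← homogeneousComponent_zero]
  conv_lhs => rw [← sum_homogeneousComponent f]
  have : f.totalDegree = 0 ∨ f.totalDegree = 1 := by omega
  rcases this with h | h
  · rw [h, homogeneousComponent_eq_zero 1 f (by omega)]; simp
  · rw [h, Finset.sum_range_succ, Finset.sum_range_one]

theorem pderiv_subst3 (M : Matrix (Fin 3) (Fin 3) ℂ) (j : Fin 3)
    (P : MvPolynomial (Fin 3) ℂ) :
    pderiv j (subst3 M P) = C (M 0 j) * subst3 M (pderiv 0 P)
      + C (M 1 j) * subst3 M (pderiv 1 P) + C (M 2 j) * subst3 M (pderiv 2 P) := by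
  induction P using MvPolynomial.induction_on with
  | C a => simp [subst3, algebraMap_eq]
  | add p q hp hq =>
    simp only [subst3, map_add] at *
    rw [hp, hq]; ring
  | mul_X p i hp =>
    simp only [subst3, map_mul, Derivation.leibniz, smul_eq_mul, aeval_X, map_add] at *
    rw [hp]
    fin_cases i <;> fin_cases j <;>
    simp [Fin.sum_univ_three, pderiv_X] <;> ring

theorem adj_col (M : Matrix (Fin 3) (Fin 3) ℂ) (i : Fin 3) (A B Cz : MvPolynomial (Fin 3) ℂ) :
    C (M i 0) * ZP M A B Cz 0 + C (M i 1) * ZP M A B Cz 1 + C (M i 2) * ZP M A B Cz 2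
     = C M.det * subst3 M (![A, B, Cz] i) := by
  fin_cases i <;> simp [ZP, Matrix.adjugate_fin_three, Matrix.det_fin_three] <;> ring

theorem Zop_subst3 (M : Matrix (Fin 3) (Fin 3) ℂ) (A B Cz P : MvPolynomial (Fin 3) ℂ) :
    Zop (ZP M A B Cz 0) (ZP M A B Cz 1) (ZP M A B Cz 2) (subst3 M P)
      = C M.det * subst3 M (Zop A B Cz P) := by
  have h0 := adj_col M 0 A B Cz
  have h1 := adj_col M 1 A B Cz
  have h2 := adj_col M 2 A B Cz
  simp only [Matrix.cons_val] at h0 h1 h2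
  simp only [Zop, pderiv_subst3]
  have : subst3 M (A * pderiv 0 P + B * pderiv 1 P + Cz * pderiv 2 P) =
    subst3 M A * subst3 M (pderiv 0 P) + subst3 M B * subst3 M (pderiv 1 P)
      + subst3 M Cz * subst3 M (pderiv 2 P) := by simp [subst3]
  rw [this]
  linear_combination subst3 M (pderiv 0 P) * h0 + subst3 M (pderiv 1 P) * h1
    + subst3 M (pderiv 2 P) * h2

theorem OmZ_ZP (M : Matrix (Fin 3) (Fin 3) ℂ) (A B Cz : MvPolynomial (Fin 3) ℂ) :
    OmZ (ZP M A B Cz 0) (ZP M A B Cz 1) (ZP M A B Cz 2) = pb3 M (OmZ A B Cz) := by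
  funext i
  fin_cases i <;>
  simp [OmZ, pb3, ZP, Matrix.adjugate_fin_three, Fin.sum_univ_three, subst3] <;> ring

theorem ZP_hom (M : Matrix (Fin 3) (Fin 3) ℂ) {A B Cz : MvPolynomial (Fin 3) ℂ}
    (hA : A.IsHomogeneous 3) (hB : B.IsHomogeneous 3) (hC : Cz.IsHomogeneous 3) (i : Fin 3) :
    (ZP M A B Cz i).IsHomogeneous 3 := by
  have h : ∀ (a : ℂ) {P : MvPolynomial (Fin 3) ℂ}, P.IsHomogeneous 3 →
      (C a * subst3 M P).IsHomogeneous 3 := fun a P hP => by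
    simpa using (isHomogeneous_C (Fin 3) a).mul (subst3_hom M hP)
  exact ((h _ hA).add (h _ hB)).add (h _ hC)

theorem Zop_add (A B Cz f g : MvPolynomial (Fin 3) ℂ) :
    Zop A B Cz (f + g) = Zop A B Cz f + Zop A B Cz g := by simp [Zop]; ring

theorem Zop_Cmul (A B Cz f : MvPolynomial (Fin 3) ℂ) (a : ℂ) :
    Zop A B Cz (C a * f) = C a * Zop A B Cz f := by simp [Zop]; ring

theorem extactic_eq (A B Cz : MvPolynomial (Fin 3) ℂ) :
    extactic A B Cz =
      Matrix.det !![X 0, A, Zop A B Cz A; X 1, B, Zop A B Cz B; X 2, Cz, Zop A B Cz Cz] := by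
  simp [extactic, Zop, pderiv_X]

theorem extactic_ZP (M : Matrix (Fin 3) (Fin 3) ℂ) (A B Cz : MvPolynomial (Fin 3) ℂ) :
    C M.det * extactic (ZP M A B Cz 0) (ZP M A B Cz 1) (ZP M A B Cz 2)
      = C M.det ^ 3 * subst3 M (extactic A B Cz) := by
  set a := ZP M A B Cz 0 with ha
  set b := ZP M A B Cz 1 with hb
  set c := ZP M A B Cz 2 with hc
  have e : ∀ i, C (M i 0) * a + C (M i 1) * b + C (M i 2) * c
     = C M.det * subst3 M (![A, B, Cz] i) := fun i => adj_col M i A B Cz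
  have e2 : ∀ i, C (M i 0) * Zop a b c a + C (M i 1) * Zop a b c b + C (M i 2) * Zop a b c c
     = C M.det ^ 2 * subst3 M (Zop A B Cz (![A, B, Cz] i)) := fun i => by
    rw [← Zop_Cmul, ← Zop_Cmul, ← Zop_Cmul, ← Zop_add, ← Zop_add, e, Zop_Cmul,
      Zop_subst3]; ring
  have e0 := e 0
  have e1 := e 1
  have e3 := e 2
  have f0 := e2 0
  have f1 := e2 1
  have f2 := e2 2
  simp only [Matrix.cons_val] at e0 e1 e3 f0 f1 f2
  have x0 : subst3 M (X 0) = C (M 0 0) * X 0 + C (M 0 1) * X 1 + C (M 0 2) * X 2 := by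
    simp [subst3, Fin.sum_univ_three]
  have x1 : subst3 M (X 1) = C (M 1 0) * X 0 + C (M 1 1) * X 1 + C (M 1 2) * X 2 := by
    simp [subst3, Fin.sum_univ_three]
  have x2 : subst3 M (X 2) = C (M 2 0) * X 0 + C (M 2 1) * X 1 + C (M 2 2) * X 2 := by
    simp [subst3, Fin.sum_univ_three]
  have hr : C M.det ^ 3 * subst3 M (extactic A B Cz) =
      Matrix.det !![subst3 M (X 0), C M.det * subst3 M A, C M.det ^ 2 * subst3 M (Zop A B Cz A);
         subst3 M (X 1), C M.det * subst3 M B, C M.det ^ 2 * subst3 M (Zop A B Cz B);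
         subst3 M (X 2), C M.det * subst3 M Cz, C M.det ^ 2 * subst3 M (Zop A B Cz Cz)] := by
    rw [extactic_eq]
    simp only [Matrix.det_fin_three, subst3, Matrix.cons_val, Matrix.of_apply, map_sub, map_add,
      map_mul]
    ring
  rw [hr, extactic_eq, ← e0, ← e1, ← e3, ← f0, ← f1, ← f2, x0, x1, x2]
  generalize Zop a b c a = a2
  generalize Zop a b c b = b2
  generalize Zop a b c c = c2
  clear_value a b c
  simp only [Matrix.det_fin_three, Matrix.cons_val, Matrix.of_apply, map_sub, map_add,
      map_mul]
  ring

theorem euler3 {A : MvPolynomial (Fin 3) ℂ} {n : ℕ} (hA : A.IsHomogeneous n) :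
    X 0 * pderiv 0 A + X 1 * pderiv 1 A + X 2 * pderiv 2 A = (n : MvPolynomial (Fin 3) ℂ) * A := by
  have := hA.sum_X_mul_pderiv
  rw [Fin.sum_univ_three] at this
  rw [this]; simp

theorem KF_OmZ {A B Cz : MvPolynomial (Fin 3) ℂ}
    (hA : A.IsHomogeneous 3) (hB : B.IsHomogeneous 3) (hC : Cz.IsHomogeneous 3) :
    KF (OmZ A B Cz) = X 2 ^ 2 * extactic A B Cz := by
  have eA := euler3 hA
  have eB := euler3 hB
  have eC := euler3 hC
  rw [extactic_eq]
  simp [KF, OmZ, Zop, Matrix.det_fin_three, pderiv_X] at *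
  linear_combination (Cz * X 2 * (X 2 * B - X 1 * Cz)) * eA
    + (Cz * X 2 * (X 0 * Cz - X 2 * A)) * eB
    - Cz * ((X 2 * B - X 1 * Cz) * X 0 + (X 0 * Cz - X 2 * A) * X 1) * eC

theorem KF_smul (c : ℂ) (Ω : Fin 3 → MvPolynomial (Fin 3) ℂ) :
    KF (fun i => C c * Ω i) = C c ^ 3 * KF Ω := by
  simp [KF]; ring
theorem extactic_hom {A B Cz : MvPolynomial (Fin 3) ℂ}
    (hA : A.IsHomogeneous 3) (hB : B.IsHomogeneous 3) (hC : Cz.IsHomogeneous 3) :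
    (extactic A B Cz).IsHomogeneous 9 := by
  have hZ : ∀ {P : MvPolynomial (Fin 3) ℂ}, P.IsHomogeneous 3 →
      (Zop A B Cz P).IsHomogeneous 5 := fun {P} hP =>
    ((hA.mul (hP.pderiv (i := 0))).add (hB.mul (hP.pderiv (i := 1)))).add
      (hC.mul (hP.pderiv (i := 2)))
  have h : ∀ (i : Fin 3) {P Q : MvPolynomial (Fin 3) ℂ}, P.IsHomogeneous 3 →
      Q.IsHomogeneous 3 → (X i * P * Zop A B Cz Q).IsHomogeneous 9 := fun i P Q hP hQ =>
    ((isHomogeneous_X ℂ i).mul hP).mul (hZ hQ)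
  have e : extactic A B Cz = X 0 * B * Zop A B Cz Cz - X 0 * Cz * Zop A B Cz B
     - X 1 * A * Zop A B Cz Cz + X 2 * A * Zop A B Cz B
     + X 1 * Cz * Zop A B Cz A - X 2 * B * Zop A B Cz A := by
    rw [extactic_eq]; simp [Matrix.det_fin_three]; ring
  rw [e]
  exact (((((h 0 hB hC).sub (h 0 hC hB)).sub (h 1 hA hC)).add (h 2 hA hB)).add
    (h 1 hC hA)).sub (h 2 hB hA)

theorem Zop_linF (A B Cz : MvPolynomial (Fin 3) ℂ) (v : Fin 3 → ℂ) :
    Zop A B Cz (linF v) = C (v 0) * A + C (v 1) * B + C (v 2) * Cz := by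
  simp [Zop, linF, Fin.sum_univ_three, pderiv_X]; ring

theorem inv_dvd {A B Cz : MvPolynomial (Fin 3) ℂ} {v : Fin 3 → ℂ}
    (h : linF v ∣ Zop A B Cz (linF v)) :
    linF v ∣ C (v 0) * OmZ A B Cz 1 - C (v 1) * OmZ A B Cz 0 := by
  have : C (v 0) * OmZ A B Cz 1 - C (v 1) * OmZ A B Cz 0
      = linF v * Cz - X 2 * Zop A B Cz (linF v) := by
    rw [Zop_linF]; simp [OmZ, linF, Fin.sum_univ_three]; ring
  rw [this]
  exact dvd_sub (dvd_mul_right _ _) (h.mul_left _)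

theorem orbit_data {A B Cz : MvPolynomial (Fin 3) ℂ}
    (hA : A.IsHomogeneous 3) (hB : B.IsHomogeneous 3) (hC : Cz.IsHomogeneous 3)
    (hfol : ∀ i, (OmZ A B Cz i).IsHomogeneous 4)
    {Ω : Fin 3 → MvPolynomial (Fin 3) ℂ} (h : LinConj3 (OmZ A B Cz) Ω) :
    (∀ i, (Ω i).IsHomogeneous 4) ∧ ∃ M : Matrix (Fin 3) (Fin 3) ℂ, IsUnit M.det ∧
      (∃ r : ℂ, KF Ω = C r * (X 2 ^ 2 * subst3 M (extactic A B Cz))) ∧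
      ∀ v, LineInvZ A B Cz (linF v) → linF (Matrix.vecMul v M) ∣
        C (Matrix.vecMul v M 0) * Ω 1 - C (Matrix.vecMul v M 1) * Ω 0 := by
  obtain ⟨M, c, hM, hc, hpb⟩ := h
  have hcc : (C c⁻¹ * C c : MvPolynomial (Fin 3) ℂ) = 1 := by
    rw [← C_mul, inv_mul_cancel₀ hc, C_1]
  have hΩ : ∀ i, Ω i = C c⁻¹ * pb3 M (OmZ A B Cz) i := fun i => by
    rw [hpb, ← mul_assoc, hcc, one_mul]
  have hK : KF Ω = C c⁻¹ ^ 3 * KF (pb3 M (OmZ A B Cz)) := by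
    rw [← KF_smul]; congr 1; funext i; exact hΩ i
  refine ⟨fun i => ?_, M, hM, ⟨c⁻¹ ^ 3 * M.det ^ 2, ?_⟩, fun v hv => ?_⟩
  · rw [hΩ]
    have := IsHomogeneous.sum Finset.univ (fun j => C (M j i) * subst3 M (OmZ A B Cz j)) 4
      (fun j _ => by
        simpa using (isHomogeneous_C (Fin 3) (M j i)).mul (subst3_hom M (hfol j)))
    simpa [pb3] using (isHomogeneous_C (Fin 3) c⁻¹).mul this
  · have hE := extactic_ZP M A B Cz
    have hd : (C M.det : MvPolynomial (Fin 3) ℂ) ≠ 0 := by simpa using hM.ne_zero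
    have hE' : extactic (ZP M A B Cz 0) (ZP M A B Cz 1) (ZP M A B Cz 2)
        = C M.det ^ 2 * subst3 M (extactic A B Cz) := by
      apply mul_left_cancel₀ hd; rw [hE]; ring
    rw [hK, ← OmZ_ZP, KF_OmZ (ZP_hom M hA hB hC 0) (ZP_hom M hA hB hC 1) (ZP_hom M hA hB hC 2),
      hE']
    simp only [C_mul, C_pow]; ring
  · have h1 : linF (Matrix.vecMul v M) ∣ Zop (ZP M A B Cz 0) (ZP M A B Cz 1) (ZP M A B Cz 2)
        (linF (Matrix.vecMul v M)) := by
      rw [← subst3_linF, Zop_subst3]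
      obtain ⟨g, hg⟩ := hv
      refine Dvd.dvd.mul_left ⟨subst3 M g, ?_⟩ _
      rw [hg]; simp [subst3]
    have h2 := inv_dvd h1
    rw [OmZ_ZP] at h2
    have : C (Matrix.vecMul v M 0) * Ω 1 - C (Matrix.vecMul v M 1) * Ω 0 =
      C c⁻¹ * (C (Matrix.vecMul v M 0) * pb3 M (OmZ A B Cz) 1
        - C (Matrix.vecMul v M 1) * pb3 M (OmZ A B Cz) 0) := by
      rw [hΩ, hΩ]; ring
    rw [this]; exact h2.mul_left _

theorem linF_smul (a : ℂ) (v : Fin 3 → ℂ) : linF (a • v) = C a * linF v := by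
  simp [linF, Finset.mul_sum, mul_assoc]

theorem normz {ι : Type} [Fintype ι] [Nonempty ι] (v : ι → ℂ) :
    ∃ (a : ℂ) (w : ι → ℂ), ‖w‖ = 1 ∧ v = a • w ∧ (v ≠ 0 → a ≠ 0) := by
  by_cases hv : v = 0
  · exact ⟨0, fun _ => 1, by simp, by simp [hv], fun h => absurd hv h⟩
  · have hn : ‖v‖ ≠ 0 := by simpa using hv
    refine ⟨(‖v‖ : ℂ), (‖v‖ : ℂ)⁻¹ • v, ?_, ?_, fun _ => by simpa using hv⟩
    · rw [norm_smul]; simp [hn]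
    · rw [smul_smul, mul_inv_cancel₀ (by simpa using hv), one_smul]

/-- Affine form. -/
def affF (v : Fin 4 → ℂ) : MvPolynomial (Fin 3) ℂ := C (v 3) + linF ![v 0, v 1, v 2]

theorem affF_smul (a : ℂ) (v : Fin 4 → ℂ) : affF (a • v) = C a * affF v := by
  simp [affF, linF, Fin.sum_univ_three]; ring

theorem orbit_data2 {A B Cz : MvPolynomial (Fin 3) ℂ}
    (hA : A.IsHomogeneous 3) (hB : B.IsHomogeneous 3) (hC : Cz.IsHomogeneous 3)
    (hfol : ∀ i, (OmZ A B Cz i).IsHomogeneous 4)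
    (hE : extactic A B Cz ≠ 0)
    {L : Fin 8 → MvPolynomial (Fin 3) ℂ}
    (hL : ∀ i, (L i).IsHomogeneous 1 ∧ L i ≠ 0 ∧ LineInvZ A B Cz (L i))
    (hd : (∏ i, L i) ∣ extactic A B Cz)
    {Ω : Fin 3 → MvPolynomial (Fin 3) ℂ} (h : LinConj3 (OmZ A B Cz) Ω) :
    ∃ (q : ℂ) (w : Fin 4 → ℂ) (l : Fin 8 → Fin 3 → ℂ), ‖w‖ = 1 ∧ (∀ i, ‖l i‖ = 1) ∧
      KF Ω = C q * (X 2 ^ 2 * (affF w * ∏ i, linF (l i))) ∧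
      ∀ i, linF (l i) ∣ C (l i 0) * Ω 1 - C (l i 1) * Ω 0 := by
  obtain ⟨-, M, hM, ⟨r, hr⟩, hinv⟩ := orbit_data hA hB hC hfol h
  obtain ⟨Q, hQ⟩ := hd
  have hQ0 : Q ≠ 0 := by rintro rfl; simp at hQ; exact hE hQ
  have hP0 : (∏ i, L i) ≠ 0 := Finset.prod_ne_zero_iff.2 fun i _ => (hL i).2.1
  have hdeg : (extactic A B Cz).totalDegree = 9 := (extactic_hom hA hB hC).totalDegree hE
  have hPdeg : (∏ i, L i).totalDegree = 8 := by
    have := IsHomogeneous.prod Finset.univ L (fun _ => 1) (fun i _ => (hL i).1)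
    simpa using this.totalDegree hP0
  have hQdeg : Q.totalDegree ≤ 1 := by
    rw [hQ, totalDegree_mul_of_isDomain hP0 hQ0, hPdeg] at hdeg; omega
  obtain ⟨a, u, hu⟩ := aff_eq hQdeg
  choose v hv using fun i => hom1_eq (hL i).1
  choose s l hl1 hl2 hl3 using fun i => normz (Matrix.vecMul (v i) M)
  have hv0 : ∀ i, Matrix.vecMul (v i) M ≠ 0 := fun i h0 => by
    have : v i = 0 := by
      have h2 := congrArg (fun w => Matrix.vecMul w M⁻¹) h0
      simpa [Matrix.vecMul_vecMul, Matrix.mul_nonsing_inv M hM] using h2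
    apply (hL i).2.1
    rw [hv, this]; simp [linF]
  obtain ⟨b, w, hw1, hw2, -⟩ := normz
    (![Matrix.vecMul u M 0, Matrix.vecMul u M 1, Matrix.vecMul u M 2, a] : Fin 4 → ℂ)
  have hsQ : subst3 M Q = C b * affF w := by
    rw [← affF_smul, ← hw2, hu]
    have : subst3 M (C a + linF u) = C a + subst3 M (linF u) := by simp [subst3, algebraMap_eq]
    rw [this, subst3_linF]
    simp [affF, linF, Fin.sum_univ_three]
  have hsL : ∀ i, subst3 M (L i) = C (s i) * linF (l i) := fun i => by
    rw [hv, subst3_linF, ← linF_smul, ← hl2]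
  refine ⟨r * b * ∏ i, s i, w, l, hw1, hl1, ?_, fun i => ?_⟩
  · have : subst3 M (extactic A B Cz) = (∏ i, subst3 M (L i)) * subst3 M Q := by
      rw [hQ]; simp [subst3]
    rw [hr, this, hsQ, Finset.prod_congr rfl fun i _ => hsL i, Finset.prod_mul_distrib]
    simp only [C_mul, map_prod]; ring
  · have h1 := hinv (v i) (by rw [← hv]; exact (hL i).2.2)
    have hs := hl3 i (hv0 i)
    rw [hl2 i, linF_smul] at h1
    have h2 := (dvd_mul_left _ _).trans h1
    have hcc : (C (s i)⁻¹ * C (s i) : MvPolynomial (Fin 3) ℂ) = 1 := by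
      rw [← C_mul, inv_mul_cancel₀ hs, C_1]
    have := h2.mul_left (C (s i)⁻¹)
    convert this using 1
    simp only [Pi.smul_apply, smul_eq_mul, C_mul]
    linear_combination (-(C (l i 0) * Ω 1 - C (l i 1) * Ω 0)) * hcc
open Filter Topology in
theorem tends_lin {T : Type*} {u : Filter T} {d : ℕ} {f : T → MvPolynomial (Fin 3) ℂ}
    {g : MvPolynomial (Fin 3) ℂ}
    (hf : ∀ᶠ t in u, (f t).IsHomogeneous d) (hg : g.IsHomogeneous d)
    (hc : ∀ m, Tendsto (fun t => coeff m (f t)) u (𝓝 (coeff m g)))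
    (φ : T → MvPolynomial (Fin 3) ℂ →ₗ[ℂ] ℂ) (ψ : MvPolynomial (Fin 3) ℂ →ₗ[ℂ] ℂ)
    (hφ : ∀ m, Tendsto (fun t => φ t (monomial m 1)) u (𝓝 (ψ (monomial m 1)))) :
    Tendsto (fun t => φ t (f t)) u (𝓝 (ψ g)) := by
  have key : ∀ (χ : MvPolynomial (Fin 3) ℂ →ₗ[ℂ] ℂ) (p : MvPolynomial (Fin 3) ℂ),
      p.IsHomogeneous d → χ p = ∑ m ∈ Finset.finsuppAntidiag Finset.univ d,
        coeff m p * χ (monomial m 1) := by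
    intro χ p hp
    have hsub : p.support ⊆ Finset.finsuppAntidiag Finset.univ d := by
      intro m hm
      rw [Finset.mem_finsuppAntidiag]
      refine ⟨?_, Finset.subset_univ _⟩
      by_contra hne
      apply (mem_support_iff.1 hm)
      apply hp.coeff_eq_zero
      rwa [Finsupp.degree_eq_sum]
    rw [← Finset.sum_subset hsub (fun m _ hm => by rw [notMem_support_iff.1 hm, zero_mul])]
    conv_lhs => rw [p.as_sum]
    rw [map_sum]
    refine Finset.sum_congr rfl fun m _ => ?_
    rw [← smul_eq_mul, ← map_smul, smul_monomial, smul_eq_mul, mul_one]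
  rw [key ψ g hg]
  refine Tendsto.congr' (f₁ := fun t => ∑ m ∈ Finset.finsuppAntidiag Finset.univ d,
        coeff m (f t) * φ t (monomial m 1)) ?_ ?_
  · filter_upwards [hf] with t ht
    exact (key _ _ ht).symm
  · exact tendsto_finsetSum _ fun m _ => (hc m).mul (hφ m)

open Filter Topology in
theorem tends_eval {T : Type*} {u : Filter T} {d : ℕ} {f : T → MvPolynomial (Fin 3) ℂ}
    {g : MvPolynomial (Fin 3) ℂ}
    (hf : ∀ᶠ t in u, (f t).IsHomogeneous d) (hg : g.IsHomogeneous d)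
    (hc : ∀ m, Tendsto (fun t => coeff m (f t)) u (𝓝 (coeff m g)))
    {p : T → Fin 3 → ℂ} {p' : Fin 3 → ℂ} (hp : Tendsto p u (𝓝 p')) :
    Tendsto (fun t => eval (p t) (f t)) u (𝓝 (eval p' g)) := by
  have := tends_lin hf hg hc (fun t => (aeval (p t)).toLinearMap) (aeval p').toLinearMap
    (fun m => by
      simp only [AlgHom.toLinearMap_apply, aeval_monomial, map_one, one_mul, Finsupp.prod_fintype,
        pow_zero, implies_true]
      exact tendsto_finsetProd _ fun i _ => ((tendsto_pi_nhds.1 hp) i).pow _)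
  simpa [aeval_eq_eval] using this

open Filter Topology in
theorem tends_KF {T : Type*} {u : Filter T} {f : T → Fin 3 → MvPolynomial (Fin 3) ℂ}
    {g : Fin 3 → MvPolynomial (Fin 3) ℂ}
    (hf : ∀ᶠ t in u, ∀ i, (f t i).IsHomogeneous 4) (hg : ∀ i, (g i).IsHomogeneous 4)
    (hc : ∀ i m, Tendsto (fun t => coeff m (f t i)) u (𝓝 (coeff m (g i))))
    (p : Fin 3 → ℂ) :
    Tendsto (fun t => eval p (KF (f t))) u (𝓝 (eval p (KF g))) := by
  have h1 : ∀ i, Tendsto (fun t => eval p (f t i)) u (𝓝 (eval p (g i))) := fun i =>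
    tends_eval (hf.mono fun t h => h i) (hg i) (hc i) tendsto_const_nhds
  have h2 : ∀ i j, Tendsto (fun t => eval p (pderiv j (f t i))) u
      (𝓝 (eval p (pderiv j (g i)))) := fun i j => by
    have := tends_lin (hf.mono fun t h => h i) (hg i) (hc i)
      (fun _ => (aeval p).toLinearMap ∘ₗ (pderiv j).toLinearMap)
      ((aeval p).toLinearMap ∘ₗ (pderiv j).toLinearMap) (fun m => tendsto_const_nhds)
    simpa [aeval_eq_eval] using this
  simp only [KF, map_sub, map_add, map_mul, map_neg]
  exact ((h1 0).mul (((h1 1).neg.mul (h2 1 0)).add ((h1 0).mul (h2 1 1)))).sub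
    ((h1 1).mul (((h1 1).neg.mul (h2 0 0)).add ((h1 0).mul (h2 0 1))))

theorem KF_F2 : KF OmF2 = 3 * X 2 ^ 2 * X 0 ^ 7 * X 1 ^ 2 := by
  simp [KF, OmF2, pderiv_X, Derivation.leibniz_pow]
  ring

theorem eval_linF (p v : Fin 3 → ℂ) : eval p (linF v) = v 0 * p 0 + v 1 * p 1 + v 2 * p 2 := by
  simp [linF, Fin.sum_univ_three]

theorem linF_ne {v : Fin 3 → ℂ} (h : v ≠ 0) : linF v ≠ 0 := by
  intro h0
  apply h
  funext i
  have := congrArg (eval (Pi.single i 1)) h0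
  rw [eval_linF] at this
  fin_cases i <;> simpa using this

theorem affF_ne {v : Fin 4 → ℂ} (h : v ≠ 0) : affF v ≠ 0 := by
  intro h0
  apply h
  have h3 := congrArg (eval 0) h0
  simp [affF, linF, Fin.sum_univ_three] at h3
  have h4 : ∀ p, eval p (affF v) = 0 := fun p => by rw [h0]; simp
  have e0 := h4 ![1, 0, 0]
  have e1 := h4 ![0, 1, 0]
  have e2 := h4 ![0, 0, 1]
  simp [affF, eval_linF, h3] at e0 e1 e2
  funext i
  fin_cases i <;> simp [*]

theorem fin_alg {q : ℂ} {w : Fin 4 → ℂ} {l : Fin 8 → Fin 3 → ℂ}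
    (h : KF OmF2 = C q * (X 2 ^ 2 * (affF w * ∏ i, linF (l i))))
    : ∃ i, l i 0 = 0 ∧ l i 2 = 0 := by
  have h1 : (3 * X 0 ^ 7 * X 1 ^ 2 : MvPolynomial (Fin 3) ℂ)
      = C q * (affF w * ∏ i, linF (l i)) := by
    apply mul_left_cancel₀ (pow_ne_zero 2 (X_ne_zero (R := ℂ) (2 : Fin 3)))
    rw [KF_F2] at h
    linear_combination h
  by_contra hcon
  push Not at hcon
  have hv : ∀ i p, eval p (linF (l i)) = 0 → p 0 = 0 ∨ p 1 = 0 := fun i p hp => by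
    have h2 := congrArg (eval p) h1
    rw [map_mul _ (C q), map_mul _ (affF w), map_prod,
      Finset.prod_eq_zero (Finset.mem_univ i) hp] at h2
    simpa using h2
  have hx : ∀ i, l i 1 = 0 ∧ l i 2 = 0 := fun i => by
    have hc : l i 2 = 0 := by
      by_contra hc
      have := hv i ![1, 1, -(l i 0 + l i 1) / l i 2] (by
        rw [eval_linF]; simp; field_simp; ring)
      simp at this
    have := hv i ![l i 1, - l i 0, 0] (by rw [eval_linF]; simp; ring)
    simp at this
    rcases this with h | h
    · exact ⟨h, hc⟩
    · exact absurd hc (hcon i h)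
  have hprod : ∏ i, linF (l i) = C (∏ i, l i 0) * X 0 ^ 8 := by
    have : ∀ i, linF (l i) = C (l i 0) * X 0 := fun i => by
      simp [linF, Fin.sum_univ_three, hx i]
    simp [this, Finset.prod_mul_distrib]
  have h2 : (3 * X 1 ^ 2 : MvPolynomial (Fin 3) ℂ)
      = C q * (affF w * (C (∏ i, l i 0) * X 0)) := by
    apply mul_left_cancel₀ (pow_ne_zero 7 (X_ne_zero (R := ℂ) (0 : Fin 3)))
    rw [hprod] at h1
    linear_combination h1
  have := congrArg (eval ![0, 1, 0]) h2
  simp at this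
/-- **Necessary condition for degenerating onto `F₂`.**
If a degree-3 foliation `F` (given by the vector field `Z = A∂x + B∂y + C∂z`)
degenerates onto `F₂` — `O(F₂) ⊆ closure(O(F))` in `F(3)` and `O(F) ≠ O(F₂)` —
then `deg I^tr_F ≥ 2`: the extactic polynomial `E` of `F` is nonzero and it is not
divisible by a product of eight (not necessarily distinct) `F`-invariant linear
forms. -/
theorem stmt_16 (A B Cz : MvPolynomial (Fin 3) ℂ)
    (hA : A.IsHomogeneous 3) (hB : B.IsHomogeneous 3) (hC : Cz.IsHomogeneous 3)
    (hgcd : ∀ h : MvPolynomial (Fin 3) ℂ, h ∣ A → h ∣ B → h ∣ Cz → IsUnit h)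
    (hfol : IsFolDeg 3 (OmZ A B Cz))
    (hdeg : OrbitOf OmF2 ⊆ FClos 3 (OrbitOf (OmZ A B Cz)))
    (hne : OrbitOf (OmZ A B Cz) ≠ OrbitOf OmF2) :
    extactic A B Cz ≠ 0 ∧
    ¬ ∃ L : Fin 8 → MvPolynomial (Fin 3) ℂ,
        (∀ i, (L i).IsHomogeneous 1 ∧ L i ≠ 0 ∧ LineInvZ A B Cz (L i)) ∧
        (∏ i, L i) ∣ extactic A B Cz := by

  obtain ⟨-, hfolh, -, -⟩ := hfol
  have hself : OmF2 ∈ OrbitOf OmF2 := by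
    refine ⟨1, 1, by simp, one_ne_zero, ?_⟩
    funext i
    have hs : ∀ P, subst3 1 P = P := fun P => by
      have : (fun i => ∑ j, C ((1 : Matrix (Fin 3) (Fin 3) ℂ) i j) * X j :
          Fin 3 → MvPolynomial (Fin 3) ℂ) = X := by
        funext i; simp [Matrix.one_apply]
      simp only [subst3]
      rw [this, aeval_X_left_apply]
    simp [pb3, hs, Matrix.one_apply]
  obtain ⟨⟨-, hF2h, -, -⟩, hcl⟩ := hdeg hself
  obtain ⟨u, huS, hu⟩ := mem_closure_iff_ultrafilter.1 hcl
  have hex : ∀ t : Fin 3 → (Fin 3 →₀ ℕ) → ℂ, ∃ Ω : Fin 3 → MvPolynomial (Fin 3) ℂ,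
      t ∈ coeffs '' OrbitOf (OmZ A B Cz) → LinConj3 (OmZ A B Cz) Ω ∧ coeffs Ω = t := fun t => by
    by_cases ht : t ∈ coeffs '' OrbitOf (OmZ A B Cz)
    · obtain ⟨Ω, h1, h2⟩ := ht
      exact ⟨Ω, fun _ => ⟨h1, h2⟩⟩
    · exact ⟨0, fun h => absurd h ht⟩
  choose Ω hΩ using hex
  have hΩu : ∀ᶠ t in (u : Filter _), LinConj3 (OmZ A B Cz) (Ω t) ∧ coeffs (Ω t) = t :=
    Filter.mem_of_superset huS hΩ
  have hhom : ∀ᶠ t in (u : Filter _), ∀ i, (Ω t i).IsHomogeneous 4 :=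
    hΩu.mono fun t ht => (orbit_data hA hB hC hfolh ht.1).1
  have hco : ∀ i m, Filter.Tendsto (fun t => coeff m (Ω t i)) u (nhds (coeff m (OmF2 i))) := by
    intro i m
    have h1 : Filter.Tendsto (fun t : Fin 3 → (Fin 3 →₀ ℕ) → ℂ => t i m) u
        (nhds (coeff m (OmF2 i))) := by
      have h2 : Continuous (fun t : Fin 3 → (Fin 3 →₀ ℕ) → ℂ => t i m) := by fun_prop
      exact (h2.tendsto (coeffs OmF2)).mono_left hu
    refine h1.congr' (hΩu.mono fun t ht => ?_)
    conv_lhs => rw [← ht.2]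
    rfl
  have hKF : ∀ p, Filter.Tendsto (fun t => eval p (KF (Ω t))) u (nhds (eval p (KF OmF2))) :=
    tends_KF hhom hF2h hco
  have hE : extactic A B Cz ≠ 0 := by
    intro h0
    have h1 := hKF ![1, 1, 1]
    have h2 : Filter.Tendsto (fun t => eval ![1, 1, 1] (KF (Ω t))) u (nhds 0) := by
      refine tendsto_const_nhds.congr' (hΩu.mono fun t ht => ?_)
      obtain ⟨-, M, -, ⟨r, hr⟩, -⟩ := orbit_data hA hB hC hfolh ht.1
      show 0 = eval _ (KF (Ω t))
      rw [hr, h0]; simp [subst3]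
    have h3 := tendsto_nhds_unique h1 h2
    rw [KF_F2] at h3
    simp at h3
  refine ⟨hE, ?_⟩
  rintro ⟨L, hL, hd⟩
  have hex : ∀ t : Fin 3 → (Fin 3 →₀ ℕ) → ℂ, ∃ (q : ℂ) (w : Fin 4 → ℂ) (l : Fin 8 → Fin 3 → ℂ),
      LinConj3 (OmZ A B Cz) (Ω t) → (‖w‖ = 1 ∧ (∀ i, ‖l i‖ = 1) ∧
      KF (Ω t) = C q * (X 2 ^ 2 * (affF w * ∏ i, linF (l i))) ∧
      ∀ i, linF (l i) ∣ C (l i 0) * Ω t 1 - C (l i 1) * Ω t 0) := fun t => by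
    by_cases ht : LinConj3 (OmZ A B Cz) (Ω t)
    · obtain ⟨q, w, l, h⟩ := orbit_data2 hA hB hC hfolh hE hL hd ht
      exact ⟨q, w, l, fun _ => h⟩
    · exact ⟨0, 0, 0, fun h => absurd h ht⟩
  choose q w l hdat using hex
  have hdu := hΩu.mono fun t ht => hdat t ht.1
  obtain ⟨w', hw', hwt⟩ : ∃ w', ‖w'‖ = 1 ∧ Filter.Tendsto w u (nhds w') := by
    obtain ⟨x, hx, hle⟩ := (isCompact_sphere (0 : Fin 4 → ℂ) 1).ultrafilter_le_nhds (u.map w)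
      (by
        rw [Filter.le_principal_iff]
        exact hdu.mono fun t ht => by simpa using ht.1)
    exact ⟨x, by simpa using hx, hle⟩
  have hlex : ∀ i, ∃ l', ‖l'‖ = 1 ∧ Filter.Tendsto (fun t => l t i) u (nhds l') := fun i => by
    obtain ⟨x, hx, hle⟩ := (isCompact_sphere (0 : Fin 3 → ℂ) 1).ultrafilter_le_nhds
      (u.map (fun t => l t i))
      (by
        rw [Filter.le_principal_iff]
        exact hdu.mono fun t ht => by simpa using ht.2.1 i)
    exact ⟨x, by simpa using hx, hle⟩
  choose l' hl' hlt using hlex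
  have hl0 : ∀ i, l' i ≠ 0 := fun i h => by have := hl' i; rw [h] at this; simp at this
  have hw0 : w' ≠ 0 := fun h => by rw [h] at hw'; simp at hw'
  have hlc : ∀ i j, Filter.Tendsto (fun t => l t i j) u (nhds (l' i j)) := fun i j =>
    (tendsto_pi_nhds.1 (hlt i)) j
  have hwc : ∀ j, Filter.Tendsto (fun t => w t j) u (nhds (w' j)) := fun j =>
    (tendsto_pi_nhds.1 hwt) j
  have hPt : ∀ p, Filter.Tendsto (fun t => eval p (X 2 ^ 2 * (affF (w t) * ∏ i, linF (l t i)))) u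
      (nhds (eval p (X 2 ^ 2 * (affF w' * ∏ i, linF (l' i))))) := by
    intro p
    simp only [affF, map_mul, map_add, map_prod, eval_linF, eval_C, Matrix.cons_val]
    refine tendsto_const_nhds.mul (((hwc 3).add ((((hwc 0).mul_const _).add
      ((hwc 1).mul_const _)).add ((hwc 2).mul_const _))).mul
      (tendsto_finsetProd _ fun i _ => ((((hlc i 0).mul_const _).add
      ((hlc i 1).mul_const _)).add ((hlc i 2).mul_const _))))
  have hP0 : (X 2 ^ 2 * (affF w' * ∏ i, linF (l' i)) : MvPolynomial (Fin 3) ℂ) ≠ 0 :=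
    mul_ne_zero (pow_ne_zero 2 (X_ne_zero _)) (mul_ne_zero (affF_ne hw0)
      (Finset.prod_ne_zero_iff.2 fun i _ => linF_ne (hl0 i)))
  obtain ⟨p, hp⟩ : ∃ p, eval p (X 2 ^ 2 * (affF w' * ∏ i, linF (l' i))) ≠ 0 := by
    by_contra hcon
    push Not at hcon
    exact hP0 (MvPolynomial.funext fun p => by rw [hcon p]; simp)
  have hKq : ∀ᶠ t in (u : Filter _), ∀ p, eval p (KF (Ω t)) =
      q t * eval p (X 2 ^ 2 * (affF (w t) * ∏ i, linF (l t i))) :=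
    hdu.mono fun t ht p => by rw [ht.2.2.1, map_mul, eval_C]
  have hq := (hKF p).div (hPt p) hp
  set q' := eval p (KF OmF2) / eval p (X 2 ^ 2 * (affF w' * ∏ i, linF (l' i))) with hq'
  have hqt : Filter.Tendsto q u (nhds q') := by
    refine hq.congr' ?_
    filter_upwards [hKq, (hPt p).eventually_ne hp] with t h1 h2
    simp only [Pi.div_apply]
    rw [h1 p, mul_div_cancel_right₀ _ h2]
  have hlim : KF OmF2 = C q' * (X 2 ^ 2 * (affF w' * ∏ i, linF (l' i))) := by
    apply MvPolynomial.funext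
    intro p
    rw [map_mul, eval_C]
    refine tendsto_nhds_unique (hKF p) ((hqt.mul (hPt p)).congr' ?_)
    exact hKq.mono fun t ht => (ht p).symm
  obtain ⟨i, hi0, hi2⟩ := fin_alg hlim
  have hi1 : l' i 1 ≠ 0 := fun h => hl0 i (by
    funext j; fin_cases j <;> simp [hi0, h, hi2])
  have hpt : Filter.Tendsto (fun t => (![1, -(l t i 0 + l t i 2) / l t i 1, 1] : Fin 3 → ℂ)) u
      (nhds ![1, 0, 1]) := by
    rw [tendsto_pi_nhds]
    intro j
    fin_cases j
    · simp
    · have := (((hlc i 0).add (hlc i 2)).neg).div (hlc i 1) hi1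
      simp only [hi0, hi2, add_zero, neg_zero, zero_div] at this
      exact this
    · simp
  have e0 := tends_eval (hhom.mono fun t h => h 0) (hF2h 0) (hco 0) hpt
  have e1 := tends_eval (hhom.mono fun t h => h 1) (hF2h 1) (hco 1) hpt
  have e := ((hlc i 0).mul e1).sub ((hlc i 1).mul e0)
  have ez : Filter.Tendsto (fun _ => (0 : ℂ)) (u : Filter (Fin 3 → (Fin 3 →₀ ℕ) → ℂ)) (nhds 0) :=
    tendsto_const_nhds
  have := tendsto_nhds_unique (e.congr' ?_) ez
  · simp [hi0, OmF2] at this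
    exact hi1 this
  · filter_upwards [hdu, (hlc i 1).eventually_ne hi1] with t ht hne1
    obtain ⟨g, hg⟩ := ht.2.2.2 i
    have h2 := congrArg (eval ![1, -(l t i 0 + l t i 2) / l t i 1, 1]) hg
    rw [map_mul _ (linF _), eval_linF, map_sub, map_mul, map_mul, eval_C, eval_C] at h2
    rw [h2]
    have : l t i 0 * (![1, -(l t i 0 + l t i 2) / l t i 1, 1] : Fin 3 → ℂ) 0
      + l t i 1 * (![1, -(l t i 0 + l t i 2) / l t i 1, 1] : Fin 3 → ℂ) 1
      + l t i 2 * (![1, -(l t i 0 + l t i 2) / l t i 1, 1] : Fin 3 → ℂ) 2 = 0 := by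
      simp; field_simp; ring
    rw [this, zero_mul]
end
end
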